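/- Let R be a commutative ring, let c be a natural number, for each v ∈ {0,1}^c let C_v be an R-module, and suppose given R-linear maps m_{vu}, r_{vu} : C_v → C_u for every pair v ≥ u. Assume: (i) for every pair w ≥ u, Σ_{v : w ≥ v ≥ u} (−1)^{|v−u|₁·(|w−v|₁−1)+1} (m_{vu} ∘ m_{wv}) = 0; and (ii) for every pair w ≥ u, Σ_{v : w ≥ v ≥ u} (−1)^{|v−u|₁·(|w−v|₁−1)+1} (r_{vu} ∘ m_{wv} − m_{vu} ∘ r_{wv}) = 0. Define endomorphisms of ⊕_{v ∈ {0,1}^c} C_v by F := Σ_{v ≥ u} (−1)^{|v−u|₁(|v−u|₁−1)/2 + Σ_i v_i} m_{vu} and 𝐑 := Σ_{v ≥ u} (−1)^{|v−u|₁(|v−u|₁−1)/2 + Σ_i v_i} r_{vu}. Then 𝐑 ∘ F = F ∘ 𝐑, i.e. 𝐑 is a chain map on the complex (⊕_v C_v, F). -/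

import Mathlib

open Finset
open scoped DirectSum Classical

/-- The L¹ distance `|v - u|₁ = ∑ i |vᵢ - uᵢ|` between two vertices of the cube `{0,1}^c`. -/
def cubeL1 {c : ℕ} (v u : Fin c → Fin 2) : ℤ := ∑ i, |(v i : ℤ) - (u i : ℤ)|

/-- The sum of coordinates `∑ i vᵢ` of a vertex of the cube `{0,1}^c`. -/
def cubeSum {c : ℕ} (v : Fin c → Fin 2) : ℤ := ∑ i, (v i : ℤ)

/-- The total endomorphism `Σ_{v ≥ u} (−1)^{|v−u|₁(|v−u|₁−1)/2 + Σᵢ vᵢ} m_{vu}` of the direct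
sum `⊕_{v} C_v`, where the `(v,u)`-term is regarded as a map from the `v`-summand to the
`u`-summand. -/
noncomputable def cubeTotal {R : Type*} [CommRing R] {c : ℕ} {C : (Fin c → Fin 2) → Type*}
    [∀ v, AddCommGroup (C v)] [∀ v, Module R (C v)]
    (m : ∀ v u : Fin c → Fin 2, C v →ₗ[R] C u) :
    (⨁ v, C v) →ₗ[R] (⨁ v, C v) :=
  ∑ p ∈ univ.filter (fun p : (Fin c → Fin 2) × (Fin c → Fin 2) => p.2 ≤ p.1),
    (DirectSum.lof R _ C p.2).comp
      (((((Int.negOnePow (cubeL1 p.1 p.2 * (cubeL1 p.1 p.2 - 1) / 2 + cubeSum p.1) : ℤˣ) : ℤ) : R) •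
          m p.1 p.2).comp (DirectSum.component R _ C p.1))

lemma cubeL1_eq_cubeSum_sub {c : ℕ} {v u : Fin c → Fin 2} (h : u ≤ v) :
    cubeL1 v u = cubeSum v - cubeSum u := by
  unfold cubeL1 cubeSum
  rw [← Finset.sum_sub_distrib]
  refine Finset.sum_congr rfl fun i _ => abs_of_nonneg ?_
  have := Fin.le_def.mp (h i)
  omega

lemma Int.add_mul_add_sub_one_ediv_two (a b : ℤ) :
    (a + b) * (a + b - 1) / 2 = a * (a - 1) / 2 + b * (b - 1) / 2 + a * b := by
  obtain ⟨k, hk⟩ := Int.even_mul_pred_self a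
  obtain ⟨l, hl⟩ := Int.even_mul_pred_self b
  have h : (a + b) * (a + b - 1) = 2 * (k + l + a * b) := by linear_combination hk + hl
  rw [h, hk, hl]
  omega

/-- The sign `(−1)^{|v−u|₁(|v−u|₁−1)/2 + Σᵢ vᵢ}` of the `(v,u)`-term of `cubeTotal`. -/
def cubeSign {c : ℕ} (v u : Fin c → Fin 2) : ℤˣ :=
  Int.negOnePow (cubeL1 v u * (cubeL1 v u - 1) / 2 + cubeSum v)

lemma cubeSign_mul_cubeSign {c : ℕ} {w v u : Fin c → Fin 2} (huv : u ≤ v) (hvw : v ≤ w) :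
    cubeSign w v * cubeSign v u =
      Int.negOnePow (cubeL1 w u * (cubeL1 w u - 1) / 2 + cubeSum w + cubeSum u + 1) *
        Int.negOnePow (cubeL1 v u * (cubeL1 w v - 1) + 1) := by
  have hwu : cubeL1 w u = cubeL1 v u + cubeL1 w v := by
    rw [cubeL1_eq_cubeSum_sub huv, cubeL1_eq_cubeSum_sub hvw,
      cubeL1_eq_cubeSum_sub (huv.trans hvw)]
    ring
  have hv : cubeSum v = cubeSum u + cubeL1 v u := by
    rw [cubeL1_eq_cubeSum_sub huv]
    ring
  rw [cubeSign, cubeSign, ← Int.negOnePow_add, ← Int.negOnePow_add, Int.negOnePow_eq_iff, hwu,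
    Int.add_mul_add_sub_one_ediv_two, hv]
  exact ⟨cubeL1 v u - cubeL1 v u * cubeL1 w v - 1, by ring⟩

section CubeTotal

variable {R : Type*} [CommRing R] {c : ℕ} {C : (Fin c → Fin 2) → Type*}
  [∀ v, AddCommGroup (C v)] [∀ v, Module R (C v)]

lemma cubeTotal_lof (m : ∀ v u : Fin c → Fin 2, C v →ₗ[R] C u) (w : Fin c → Fin 2) (x : C w) :
    cubeTotal m (DirectSum.lof R _ C w x) =
      ∑ u ∈ univ.filter (fun u => u ≤ w),
        ((cubeSign w u : ℤ) : R) • DirectSum.lof R _ C u (m w u x) := by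
  rw [cubeTotal, Finset.sum_filter, Fintype.sum_prod_type, LinearMap.sum_apply,
    Finset.sum_eq_single w, Finset.sum_filter, LinearMap.sum_apply]
  · refine Finset.sum_congr rfl fun u _ => ?_
    split_ifs <;> simp [cubeSign, DirectSum.component.lof_self]
  · intro v _ hv
    rw [LinearMap.sum_apply]
    refine Finset.sum_eq_zero fun u _ => ?_
    split_ifs
    · simp [DirectSum.component.of, hv.symm]
    · simp
  · simp

lemma cubeTotal_cubeTotal_lof (r m : ∀ v u : Fin c → Fin 2, C v →ₗ[R] C u)
    (w : Fin c → Fin 2) (x : C w) :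
    cubeTotal r (cubeTotal m (DirectSum.lof R _ C w x)) =
      ∑ u ∈ univ.filter (fun u => u ≤ w),
        ((Int.negOnePow (cubeL1 w u * (cubeL1 w u - 1) / 2 + cubeSum w + cubeSum u + 1) : ℤ) : R) •
          DirectSum.lof R _ C u (∑ v ∈ univ.filter (fun v => u ≤ v ∧ v ≤ w),
            ((Int.negOnePow (cubeL1 v u * (cubeL1 w v - 1) + 1) : ℤ) : R) •
              r v u (m w v x)) := by
  simp only [cubeTotal_lof, map_sum, map_smul, Finset.smul_sum, smul_smul]
  rw [Finset.sum_comm' (t' := univ.filter (fun u => u ≤ w))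
    (s' := fun u => univ.filter (fun v => u ≤ v ∧ v ≤ w))]
  · refine Finset.sum_congr rfl fun u _ => Finset.sum_congr rfl fun v hv => ?_
    obtain ⟨huv, hvw⟩ := (Finset.mem_filter.mp hv).2
    have h := congrArg (fun z : ℤˣ => ((z : ℤ) : R)) (cubeSign_mul_cubeSign huv hvw)
    simp only [Units.val_mul, Int.cast_mul] at h
    rw [h]
  · intro v u
    simp only [Finset.mem_filter, Finset.mem_univ, true_and]
    exact ⟨fun h => ⟨⟨h.2, h.1⟩, h.2.trans h.1⟩, fun h => ⟨h.1.2, h.1.1⟩⟩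

end CubeTotal

/-- Given `R`-linear maps `m_{vu}, r_{vu} : C_v → C_u` for all pairs `v ≥ u`
in the cube `{0,1}^c` satisfying
`Σ_{w ≥ v ≥ u} (−1)^{|v−u|₁(|w−v|₁−1)+1} m_{vu} ∘ m_{wv} = 0` and
`Σ_{w ≥ v ≥ u} (−1)^{|v−u|₁(|w−v|₁−1)+1} (r_{vu} ∘ m_{wv} − m_{vu} ∘ r_{wv}) = 0`,
the total endomorphisms `F := Σ_{v ≥ u} (−1)^{…} m_{vu}` and `𝐑 := Σ_{v ≥ u} (−1)^{…} r_{vu}`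
of `⊕_v C_v` satisfy `𝐑 ∘ F = F ∘ 𝐑`, i.e. `𝐑` is a chain map on `(⊕_v C_v, F)`. -/
theorem cube_chain_map (R : Type*) [CommRing R] (c : ℕ)
    (C : (Fin c → Fin 2) → Type*)
    [∀ v, AddCommGroup (C v)] [∀ v, Module R (C v)]
    (m r : ∀ v u : Fin c → Fin 2, C v →ₗ[R] C u)
    (hm : ∀ w u : Fin c → Fin 2, u ≤ w →
      (∑ v ∈ univ.filter (fun v : Fin c → Fin 2 => u ≤ v ∧ v ≤ w),
        (((Int.negOnePow (cubeL1 v u * (cubeL1 w v - 1) + 1) : ℤˣ) : ℤ) : R) •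
          ((m v u).comp (m w v))) = 0)
    (hr : ∀ w u : Fin c → Fin 2, u ≤ w →
      (∑ v ∈ univ.filter (fun v : Fin c → Fin 2 => u ≤ v ∧ v ≤ w),
        (((Int.negOnePow (cubeL1 v u * (cubeL1 w v - 1) + 1) : ℤˣ) : ℤ) : R) •
          ((r v u).comp (m w v) - (m v u).comp (r w v))) = 0) :
    (cubeTotal r).comp (cubeTotal m) = (cubeTotal m).comp (cubeTotal r) := by
  refine DirectSum.linearMap_ext R fun w => LinearMap.ext fun x => ?_
  simp only [LinearMap.comp_apply, cubeTotal_cubeTotal_lof]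
  refine Finset.sum_congr rfl fun u hu => ?_
  congr 2
  have h := LinearMap.congr_fun (hr w u (Finset.mem_filter.mp hu).2) x
  simp only [LinearMap.sum_apply, LinearMap.smul_apply, LinearMap.sub_apply,
    LinearMap.comp_apply, LinearMap.zero_apply, smul_sub, Finset.sum_sub_distrib] at h
  exact sub_eq_zero.mp h
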